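/- arXiv:1302.2354 — 4 statements merged into one kernel-verified Lean document; each statement's English description precedes it below -/
import Mathlib

section
/- Let K be a convex body in ℝ³ containing the origin in its interior. If for every plane P passing through the origin the intersection P ∩ K is a polygon (the convex hull of finitely many points of P), then K is a polyhedron (the convex hull of finitely many points). -/
noncomputable section

open Module

/-- A *polygon* is a compact convex subset of a 2-dimensional plane that is the
convex hull of a finite set of points. -/
def IsPolygon (S : Set (EuclideanSpace ℝ (Fin 3))) : Prop :=
  IsCompact S ∧ Convex ℝ S ∧
    (∃ Q : AffineSubspace ℝ (EuclideanSpace ℝ (Fin 3)),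
      finrank ℝ Q.direction = 2 ∧ S ⊆ (Q : Set (EuclideanSpace ℝ (Fin 3)))) ∧
    ∃ F : Set (EuclideanSpace ℝ (Fin 3)), F.Finite ∧ S = convexHull ℝ F

open Set Filter Topology
open scoped RealInnerProductSpace

section Sections

variable {V : Type*} [NormedAddCommGroup V] [InnerProductSpace ℝ V]

theorem Convex.smul_add_smul_mem_of_zero_mem {K : Set V} (hK : Convex ℝ K) (h0 : (0 : V) ∈ K)
    {x y : V} (hx : x ∈ K) (hy : y ∈ K) {a b : ℝ} (ha : 0 ≤ a) (hb : 0 ≤ b) (hab : a + b ≤ 1) :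
    a • x + b • y ∈ K := by
  rcases (add_nonneg ha hb).eq_or_lt with h | h
  · obtain rfl : a = 0 := by linarith
    obtain rfl : b = 0 := by linarith
    simpa using h0
  · have := hK.smul_mem_of_zero_mem h0 (convex_iff_div.1 hK hx hy ha hb h) ⟨h.le, hab⟩
    rwa [smul_add, smul_smul, smul_smul, mul_div_cancel₀ _ h.ne', mul_div_cancel₀ _ h.ne'] at this

/-- A radially maximal point of `K` is the endpoint of a segment in the radial boundary of `K`,
inside any plane through the origin and this point whose section is a polygon. -/
theorem exists_radial_boundary_segment {K : Set V} (hK : Convex ℝ K) (h0 : (0 : V) ∈ interior K)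
    {p v : V} (hp : p ∈ K) (htop : ∀ t : ℝ, 1 < t → t • p ∉ K) (hv : v ≠ 0) (hpv : ⟪p, v⟫ = 0)
    (hsec : ∃ F : Set V, F.Finite ∧ (Submodule.span ℝ {p, v} : Set V) ∩ K = convexHull ℝ F) :
    ∃ α β : ℝ, 0 < β ∧ α • p + β • v ∈ K ∧
      ∀ t : ℝ, 1 < t → t • ((1 / 2 : ℝ) • p + (1 / 2 : ℝ) • (α • p + β • v)) ∉ K := by
  obtain ⟨F, hF, hFK⟩ := hsec
  have hp0 : p ≠ 0 := by
    rintro rfl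
    exact htop 2 (by norm_num) (by simpa using interior_subset h0)
  have hpp : ⟪p, p⟫ ≠ 0 := inner_self_ne_zero.2 hp0
  have hvv : ⟪v, v⟫ ≠ 0 := inner_self_ne_zero.2 hv
  have hvp : ⟪v, p⟫ = 0 := by rw [real_inner_comm]; exact hpv
  let A : V →ₗ[ℝ] ℝ := (⟪p, p⟫)⁻¹ • (innerₛₗ ℝ p)
  let B : V →ₗ[ℝ] ℝ := (⟪v, v⟫)⁻¹ • (innerₛₗ ℝ v)
  have hAp : A p = 1 := by simp [A, hp0]
  have hAv : A v = 0 := by simp [A, hpv]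
  have hBp : B p = 0 := by simp [B, hvp]
  have hBv : B v = 1 := by simp [B, hv]
  have hspan : ∀ y ∈ Submodule.span ℝ {p, v}, y = A y • p + B y • v := by
    intro y hy
    obtain ⟨a, b, rfl⟩ := Submodule.mem_span_pair.1 hy
    simp [hAp, hAv, hBp, hBv]
  have hmem : ∀ a b : ℝ, a • p + b • v ∈ Submodule.span ℝ {p, v} := fun a b =>
    Submodule.mem_span_pair.2 ⟨a, b, rfl⟩
  have hFsub : ∀ f ∈ F, f ∈ Submodule.span ℝ {p, v} ∧ f ∈ K := fun f hf => by
    have : f ∈ (Submodule.span ℝ {p, v} : Set V) ∩ K := hFK ▸ subset_convexHull ℝ F hf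
    exact this
  obtain ⟨f₀, hf₀, hf₀B⟩ : ∃ f ∈ F, 0 < B f := by
    by_contra! hneg
    have hev : ∀ᶠ t : ℝ in 𝓝 0, t • v ∈ K := by
      have hc : Tendsto (fun t : ℝ => t • v) (𝓝 0) (𝓝 0) := by
        have : Continuous fun t : ℝ => t • v := by fun_prop
        simpa using this.tendsto 0
      exact hc (mem_interior_iff_mem_nhds.1 h0)
    obtain ⟨t, ht, htpos⟩ := ((hev.filter_mono nhdsWithin_le_nhds).and
      (self_mem_nhdsWithin : Ioi (0 : ℝ) ∈ 𝓝[>] 0)).exists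
    have h1 : t • v ∈ convexHull ℝ F := hFK ▸ ⟨by simpa using hmem 0 t, ht⟩
    have h2 : convexHull ℝ F ⊆ {y | B y ≤ 0} :=
      convexHull_min hneg (convex_halfSpace_le B.isLinear 0)
    have h3 : B (t • v) ≤ 0 := h2 h1
    rw [map_smul, hBv, smul_eq_mul, mul_one] at h3
    exact absurd htpos (not_lt.2 h3)
  obtain ⟨q, ⟨hqF, hqB⟩, hqmax⟩ := Set.exists_max_image {f ∈ F | 0 < B f}
    (fun f => (A f - 1) / B f) (hF.subset (sep_subset _ _)) ⟨f₀, hf₀, hf₀B⟩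
  change 0 < B q at hqB
  obtain ⟨hqs, hqK⟩ := hFsub q hqF
  set σ := (A q - 1) / B q with hσ
  have hqψ : A q - σ * B q = 1 := by rw [hσ]; field_simp; ring
  have hray : ∀ a : ℝ, a • p ∈ K → a ≤ 1 := fun a ha => not_lt.1 fun h => htop a h ha
  have hψF : ∀ f ∈ F, A f - σ * B f ≤ 1 := by
    intro f hf
    obtain ⟨hfs, hfK⟩ := hFsub f hf
    rcases lt_trichotomy (B f) 0 with hb | hb | hb
    · by_contra! hgt
      have hd : 0 < B q - B f := by linarith
      have hmemK := hK hfK hqK (div_nonneg hqB.le hd.le)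
        (div_nonneg (neg_nonneg.2 hb.le) hd.le) (by field_simp; ring)
      have hA := hspan _ (Submodule.add_mem _ (Submodule.smul_mem _ (B q / (B q - B f)) hfs)
        (Submodule.smul_mem _ (-B f / (B q - B f)) hqs))
      have hB0 : B ((B q / (B q - B f)) • f + (-B f / (B q - B f)) • q) = 0 := by
        simp only [map_add, map_smul, smul_eq_mul]; field_simp; ring
      rw [hB0, zero_smul, add_zero] at hA
      rw [hA] at hmemK
      have := hray _ hmemK
      simp only [map_add, map_smul, smul_eq_mul] at this
      rw [div_mul_eq_mul_div, div_mul_eq_mul_div, ← add_div, div_le_one hd] at this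
      nlinarith [mul_pos hqB (sub_pos.2 hgt)]
    · have := hspan f hfs
      rw [hb, zero_smul, add_zero] at this
      rw [hb, mul_zero, sub_zero]
      exact hray _ (this ▸ hfK)
    · have := hqmax f ⟨hf, hb⟩
      have h := (div_le_iff₀ hb).1 this
      linarith
  have hψ : ∀ y ∈ Submodule.span ℝ {p, v}, y ∈ K → (A - σ • B) y ≤ 1 := by
    intro y hys hyK
    have h2 : convexHull ℝ F ⊆ {y | (A - σ • B) y ≤ 1} :=
      convexHull_min (fun f hf => by simpa using hψF f hf)
        (convex_halfSpace_le (A - σ • B).isLinear 1)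
    exact h2 (hFK ▸ ⟨hys, hyK⟩)
  refine ⟨A q, B q, hqB, hspan q hqs ▸ hqK, fun t ht htK => ?_⟩
  rw [← hspan q hqs] at htK
  have hps : p ∈ Submodule.span ℝ {p, v} := Submodule.subset_span (by simp)
  have := hψ _ (Submodule.smul_mem _ t (Submodule.add_mem _ (Submodule.smul_mem _ _ hps)
    (Submodule.smul_mem _ _ hqs))) htK
  have hψp : (A - σ • B) p = 1 := by simp [hAp, hBp]
  have hψq : (A - σ • B) q = 1 := by simpa using hqψ
  rw [map_smul, map_add, map_smul, map_smul, hψp, hψq] at this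
  norm_num at this
  linarith

/-- On one side of the plane spanned by `p` and `d`, a wedge of directions around `d` contains no
extreme points of `K` close to the radially maximal point `p`. -/
theorem exists_wedge_extremePoints_eq {K : Set V} (hK : Convex ℝ K) (h0 : (0 : V) ∈ interior K)
    (hsec : ∀ x y : V, x ≠ 0 → y ≠ 0 → ⟪x, y⟫ = 0 →
      ∃ F : Set V, F.Finite ∧ (Submodule.span ℝ {x, y} : Set V) ∩ K = convexHull ℝ F)
    {p d e : V} (hp : p ∈ K) (htop : ∀ t : ℝ, 1 < t → t • p ∉ K) (hd : d ≠ 0) (he : e ≠ 0)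
    (hpd : ⟪p, d⟫ = 0) (hpe : ⟪p, e⟫ = 0) (hde : ⟪d, e⟫ = 0) :
    ∃ k l M : ℝ, ∀ a b c : ℝ, 0 ≤ c → M * c ≤ b → 0 < a - k * b - l * c →
      a • p + b • d + c • e ∈ extremePoints ℝ K → a • p + b • d + c • e = p := by
  have h0K := interior_subset h0
  have ne_zero_of_top : ∀ x : V, (∀ t : ℝ, 1 < t → t • x ∉ K) → x ≠ 0 := by
    rintro x hx rfl
    exact hx 2 (by norm_num) (by simpa using h0K)
  obtain ⟨α, β, hβ, hqK, hr⟩ := exists_radial_boundary_segment hK h0 hp htop hd hpd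
    (hsec p d (ne_zero_of_top p htop) hd hpd)
  set q := α • p + β • d with hq
  set r := (1 / 2 : ℝ) • p + (1 / 2 : ℝ) • q with hrdef
  have hrK : r ∈ K := hK hp hqK (by norm_num) (by norm_num) (by norm_num)
  have hre : ⟪r, e⟫ = 0 := by
    simp [hrdef, hq, inner_add_left, inner_smul_left, hpe, hde]
  obtain ⟨μ, s, hs, hwK, hm⟩ := exists_radial_boundary_segment hK h0 hrK hr he hre
    (hsec r e (ne_zero_of_top r hr) he hre)
  set w := μ • r + s • e with hw
  set m := (1 / 2 : ℝ) • r + (1 / 2 : ℝ) • w with hmdef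
  have hmint : m ∉ interior K := by
    intro hmi
    have hc : Tendsto (fun t : ℝ => t • m) (𝓝 1) (𝓝 m) := by
      have : Continuous fun t : ℝ => t • m := by fun_prop
      simpa using this.tendsto 1
    have hev : ∀ᶠ t : ℝ in 𝓝 1, t • m ∈ K := hc (mem_interior_iff_mem_nhds.1 hmi)
    obtain ⟨t, ht, htgt⟩ := ((hev.filter_mono nhdsWithin_le_nhds).and
      (self_mem_nhdsWithin : Ioi (1 : ℝ) ∈ 𝓝[>] 1)).exists
    exact hm t htgt ht
  obtain ⟨f, hf⟩ := geometric_hahn_banach_open_point hK.interior isOpen_interior hmint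
  have hfK : ∀ y ∈ K, f y ≤ f m := by
    have hsub : K ⊆ closure (interior K) := by
      rw [hK.closure_interior_eq_closure_of_nonempty_interior ⟨0, h0⟩]
      exact subset_closure
    have hclosed : IsClosed {y | f y ≤ f m} := isClosed_le f.continuous continuous_const
    exact fun y hy => (closure_minimal (fun z hz => (hf z hz).le) hclosed) (hsub hy)
  have hfm : 0 < f m := by simpa using hf 0 h0
  have hfr : f r = 1 / 2 * f p + 1 / 2 * f q := by simp [hrdef]
  have hfm' : f m = 1 / 2 * f r + 1 / 2 * f w := by simp [hmdef]
  have hfp := hfK p hp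
  have hfq := hfK q hqK
  have hfw := hfK w hwK
  refine ⟨α / β, μ / (2 * s), β * μ / (2 * s), fun a b c hc hbc ha hx => ?_⟩
  set A := a - α / β * b - μ / (2 * s) * c with hA
  set B := b / β - μ * c / (2 * s) with hB
  set C := c / s with hC
  have hBnn : 0 ≤ B := by
    rw [hB, sub_nonneg, le_div_iff₀ hβ]
    refine le_trans (le_of_eq ?_) hbc
    ring
  have hCnn : 0 ≤ C := div_nonneg hc hs.le
  have hxeq : a • p + b • d + c • e = A • p + (B • q + C • w) := by
    rw [hw, hrdef, hq]
    have h1 : A + B * α + C * μ * (1 / 2) + C * μ * (1 / 2) * α = a := by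
      rw [hA, hB, hC]; field_simp; ring
    have h2 : B * β + C * μ * (1 / 2) * β = b := by
      rw [hB, hC]; field_simp; ring
    have h3 : C * s = c := by rw [hC]; field_simp
    rw [← h3]
    nth_rewrite 1 [← h1, ← h2]
    module
  rw [hxeq] at hx ⊢
  obtain ⟨hxK, hext⟩ := mem_extremePoints_iff_left.1 hx
  have hsum : A + (B + C) ≤ 1 := by
    have := hfK _ hxK
    have hp' : f p = f m := by linarith
    have hq' : f q = f m := by linarith
    have hw' : f w = f m := by linarith
    simp only [map_add, map_smul, smul_eq_mul, hp', hq', hw'] at this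
    by_contra! h
    nlinarith
  rcases (show A ≤ 1 by linarith).eq_or_lt with hA1 | hA1
  · obtain hB0 : B = 0 := by linarith
    obtain hC0 : C = 0 := by linarith
    rw [hA1, hB0, hC0]; simp
  · have hA1' : 0 < 1 - A := by linarith
    refine (hext p hp ((B / (1 - A)) • q + (C / (1 - A)) • w) ?_
      ⟨A, 1 - A, ha, hA1', by ring, ?_⟩).symm
    · refine hK.smul_add_smul_mem_of_zero_mem h0K hqK hwK (by positivity) (by positivity) ?_
      rw [← add_div, div_le_one hA1']; linarith
    · rw [smul_add, smul_smul, smul_smul, mul_div_cancel₀ _ hA1'.ne', mul_div_cancel₀ _ hA1'.ne']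

/-- In dimension three, the extreme points of `K` do not accumulate at a radially maximal point. -/
theorem not_accPt_extremePoints_of_radially_maximal {K : Set V} (hdim : finrank ℝ V = 3)
    (hK : Convex ℝ K) (h0 : (0 : V) ∈ interior K)
    (hsec : ∀ x y : V, x ≠ 0 → y ≠ 0 → ⟪x, y⟫ = 0 →
      ∃ F : Set V, F.Finite ∧ (Submodule.span ℝ {x, y} : Set V) ∩ K = convexHull ℝ F)
    {p : V} (hp : p ∈ K) (htop : ∀ t : ℝ, 1 < t → t • p ∉ K) :
    ¬ AccPt p (𝓟 (extremePoints ℝ K)) := by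
  intro hacc
  have : FiniteDimensional ℝ V := .of_finrank_pos (by omega)
  have h0K := interior_subset h0
  have hp0 : p ≠ 0 := by
    rintro rfl
    exact htop 2 (by norm_num) (by simpa using h0K)
  have hnp : 0 < ‖p‖ := norm_pos_iff.2 hp0
  set u : V := ‖p‖⁻¹ • p with hu
  have hup : p = ‖p‖ • u := by rw [hu, smul_inv_smul₀ hnp.ne']
  have hunorm : ‖u‖ = 1 := by rw [hu, norm_smul, norm_inv, norm_norm, inv_mul_cancel₀ hnp.ne']
  have huu : ⟪u, u⟫ = 1 := by rw [real_inner_self_eq_norm_sq, hunorm, one_pow]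
  have hupos : 0 < ⟪u, p⟫ := by
    rw [hup, inner_smul_right, huu]; simpa using hnp
  let z : V → V := fun x => x - ⟪u, x⟫ • u
  let D : V → V := fun x => ‖z x‖⁻¹ • z x
  set L := 𝓝[≠] p ⊓ 𝓟 (extremePoints ℝ K)
  have hLne : NeBot L := hacc
  have hLp : L ≤ 𝓝 p := inf_le_left.trans nhdsWithin_le_nhds
  have hLE : ∀ᶠ x in L, x ∈ extremePoints ℝ K :=
    (show L ≤ 𝓟 (extremePoints ℝ K) from inf_le_right) (mem_principal_self _)
  have hLnp : ∀ᶠ x in L, x ≠ p :=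
    (show L ≤ 𝓝[≠] p from inf_le_left) self_mem_nhdsWithin
  have hz : ∀ᶠ x in L, z x ≠ 0 := by
    have hpos : ∀ᶠ x in L, 0 < ⟪u, x⟫ :=
      hLp ((show Continuous fun x : V => ⟪u, x⟫ by fun_prop).continuousAt.eventually
        (lt_mem_nhds hupos))
    filter_upwards [hLE, hLnp, hpos] with x hxE hxp hx hzx
    obtain ⟨hxK, hext⟩ := mem_extremePoints.1 hxE
    have hxu : x = (⟪u, x⟫ / ‖p‖) • p := by
      nth_rewrite 2 [hup]
      rw [smul_smul, div_mul_cancel₀ _ hnp.ne']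
      exact sub_eq_zero.1 hzx
    set τ := ⟪u, x⟫ / ‖p‖ with hτ
    have hτ0 : 0 < τ := div_pos hx hnp
    rcases lt_trichotomy τ 1 with h | h | h
    · have := (hext 0 h0K p hp ⟨1 - τ, τ, by linarith, hτ0, by ring, by simp [← hxu]⟩).2
      exact hxp this.symm
    · rw [h, one_smul] at hxu
      exact hxp hxu
    · exact htop τ h (hxu ▸ hxK)
  have hzu : ∀ x, ⟪u, z x⟫ = 0 := fun x => by
    simp only [z, inner_sub_right, inner_smul_right, huu, mul_one, sub_self]
  have hcomp : IsCompact (Metric.sphere (0 : V) 1 ∩ {y | ⟪u, y⟫ = 0}) :=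
    (isCompact_sphere 0 1).inter_right (isClosed_eq (by fun_prop) continuous_const)
  obtain ⟨d, ⟨hd1, hud⟩, hclus⟩ := hcomp.exists_mapClusterPt (f := L) (u := D) (by
    rw [le_principal_iff, mem_map]
    filter_upwards [hz] with x hx
    have hx' : ‖z x‖ ≠ 0 := norm_ne_zero_iff.2 hx
    refine ⟨?_, ?_⟩
    · simp [D, norm_smul, hx']
    · simp [D, inner_smul_right, hzu])
  replace hd1 : ‖d‖ = 1 := by simpa using hd1
  change ⟪u, d⟫ = 0 at hud
  have hdd : ⟪d, d⟫ = 1 := by rw [real_inner_self_eq_norm_sq, hd1, one_pow]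
  have hdu : ⟪d, u⟫ = 0 := by rw [real_inner_comm]; exact hud
  obtain ⟨b, hb⟩ := Orthonormal.exists_orthonormalBasis_extension_of_card_eq (𝕜 := ℝ) (E := V)
    (ι := Fin 3) (by simpa using hdim) (v := ![u, d, 0]) (s := {0, 1}) (by
      rw [orthonormal_iff_ite]
      rintro ⟨i, rfl | rfl⟩ ⟨j, rfl | rfl⟩ <;> simp [hud, hdu, hunorm, hd1, Subtype.ext_iff])
  have hb0 : b 0 = u := by simpa using hb 0 (by simp)
  have hb1 : b 1 = d := by simpa using hb 1 (by simp)
  set e := b 2 with he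
  have hue : ⟪u, e⟫ = 0 := by rw [← hb0]; exact b.orthonormal.2 (by decide)
  have hde : ⟪d, e⟫ = 0 := by rw [← hb1]; exact b.orthonormal.2 (by decide)
  have heu : ⟪e, u⟫ = 0 := by rw [real_inner_comm]; exact hue
  have hed : ⟪e, d⟫ = 0 := by rw [real_inner_comm]; exact hde
  have he0 : e ≠ 0 := b.orthonormal.ne_zero 2
  have hd0 : d ≠ 0 := norm_ne_zero_iff.1 (by rw [hd1]; exact one_ne_zero)
  have hpd : ⟪p, d⟫ = 0 := by rw [hup, inner_smul_left, hud, mul_zero]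
  have hpe : ⟪p, e⟫ = 0 := by rw [hup, inner_smul_left, hue, mul_zero]
  have hdp : ⟪d, p⟫ = 0 := by rw [real_inner_comm]; exact hpd
  have hep : ⟪e, p⟫ = 0 := by rw [real_inner_comm]; exact hpe
  have hcoord : ∀ x : V, x = (⟪u, x⟫ / ‖p‖) • p + ⟪d, x⟫ • d + ⟪e, x⟫ • e := by
    intro x
    have := b.sum_repr' x
    rw [Fin.sum_univ_three, hb0, hb1, ← he] at this
    nth_rewrite 2 [hup]
    rw [smul_smul, div_mul_cancel₀ _ hnp.ne', this]
  obtain ⟨k, l, M, hwedge⟩ := exists_wedge_extremePoints_eq hK h0 hsec hp htop hd0 he0 hpd hpe hde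
  obtain ⟨k', l', M', hwedge'⟩ := exists_wedge_extremePoints_eq hK h0 hsec hp htop hd0
    (neg_ne_zero.2 he0) hpd (by rw [inner_neg_right, hpe, neg_zero])
    (by rw [inner_neg_right, hde, neg_zero])
  have hnear : ∀ k l : ℝ, ∀ᶠ x in L, 0 < ⟪u, x⟫ / ‖p‖ - k * ⟪d, x⟫ - l * ⟪e, x⟫ := fun k l =>
    hLp ((show Continuous fun x : V => ⟪u, x⟫ / ‖p‖ - k * ⟪d, x⟫ - l * ⟪e, x⟫ by
      fun_prop).continuousAt.eventually (lt_mem_nhds (by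
        beta_reduce
        rw [hdp, hep, mul_zero, mul_zero, sub_zero, sub_zero]; exact div_pos hupos hnp)))
  have hdir : ∀ M : ℝ, ∀ᶠ y in 𝓝 d, M * ⟪e, y⟫ < ⟪d, y⟫ := fun M =>
    (show ContinuousAt (fun y : V => M * ⟪e, y⟫) d by fun_prop).eventually_lt
      (by fun_prop) (by rw [hed, hdd, mul_zero]; exact one_pos)
  obtain ⟨x, ⟨hx1, hx2⟩, hxz, hxE, hxp, hx3, hx4⟩ :=
    ((hclus.frequently ((hdir M).and (hdir (-M')))).and_eventually
      (hz.and (hLE.and (hLnp.and ((hnear k l).and (hnear k' (-l'))))))).exists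
  have hnz : 0 < ‖z x‖ := norm_pos_iff.2 hxz
  have hscale : ∀ y : V, ⟪y, u⟫ = 0 → ⟪y, D x⟫ = ‖z x‖⁻¹ * ⟪y, x⟫ := fun y hy => by
    simp only [D, z, inner_smul_right, inner_sub_right, hy, mul_zero, sub_zero]
  rw [hscale e heu, hscale d hdu, mul_left_comm, mul_lt_mul_iff_right₀ (inv_pos.2 hnz)] at hx1 hx2
  have hxE' := hxE
  have hxc := hcoord x
  rw [hxc] at hxE'
  rcases le_total 0 ⟪e, x⟫ with hc | hc
  · exact hxp (hxc.trans (hwedge _ _ _ hc hx1.le hx3 hxE'))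
  · rw [← neg_smul_neg ⟪e, x⟫ e] at hxE' hxc
    exact hxp (hxc.trans (hwedge' _ _ _ (neg_nonneg.2 hc) (by linarith) (by linarith) hxE'))

end Sections

/-- If `K` is a convex body in `ℝ³` with the origin in its interior and the
intersection of `K` with every plane through the origin is a polygon, then `K`
is a polyhedron. -/
theorem klee_reformulation
    (K : Set (EuclideanSpace ℝ (Fin 3)))
    (hKcomp : IsCompact K) (hKconv : Convex ℝ K) (hKint : (interior K).Nonempty)
    (h0 : (0 : EuclideanSpace ℝ (Fin 3)) ∈ interior K)
    (hsec : ∀ P : Submodule ℝ (EuclideanSpace ℝ (Fin 3)), finrank ℝ P = 2 →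
      IsPolygon ((P : Set (EuclideanSpace ℝ (Fin 3))) ∩ K)) :
    ∃ F : Set (EuclideanSpace ℝ (Fin 3)), F.Finite ∧ K = convexHull ℝ F := by
  have hdim : finrank ℝ (EuclideanSpace ℝ (Fin 3)) = 3 := by simp
  have hsec' : ∀ x y : EuclideanSpace ℝ (Fin 3), x ≠ 0 → y ≠ 0 → ⟪x, y⟫ = 0 →
      ∃ F : Set (EuclideanSpace ℝ (Fin 3)), F.Finite ∧
        (Submodule.span ℝ {x, y} : Set (EuclideanSpace ℝ (Fin 3))) ∩ K = convexHull ℝ F := by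
    intro x y hx hy hxy
    have hli : LinearIndependent ℝ ![x, y] := by
      rw [LinearIndependent.pair_iff' hx]
      rintro a rfl
      rw [inner_smul_right, mul_eq_zero, inner_self_eq_zero] at hxy
      rcases hxy with rfl | rfl
      · exact hy (zero_smul ℝ x)
      · exact hx rfl
    have hrank : finrank ℝ (Submodule.span ℝ {x, y}) = 2 := by
      rw [← Matrix.range_cons_cons_empty x y ![]]
      exact finrank_span_eq_card hli
    exact (hsec _ hrank).2.2.2
  have hfin : (extremePoints ℝ K).Finite := by
    by_contra hinf
    obtain ⟨p, hp, hacc⟩ :=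
      Set.Infinite.exists_accPt_of_subset_isCompact hinf hKcomp extremePoints_subset
    by_cases htop : ∀ t : ℝ, 1 < t → t • p ∉ K
    · exact not_accPt_extremePoints_of_radially_maximal hdim hKconv h0 hsec' hp htop hacc
    · push Not at htop
      obtain ⟨t, ht, htK⟩ := htop
      have ht0 : 0 < t := by linarith
      have hpint : p ∈ interior K := by
        refine hKconv.openSegment_interior_self_subset_interior h0 htK
          ⟨1 - t⁻¹, t⁻¹, sub_pos.2 (inv_lt_one_of_one_lt₀ ht), inv_pos.2 ht0, by ring, ?_⟩
        rw [smul_zero, zero_add, inv_smul_smul₀ ht0.ne']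
      obtain ⟨x, ⟨hxK, hxE⟩, -⟩ := accPt_iff_nhds.1 hacc _ (isOpen_interior.mem_nhds hpint)
      exact Set.disjoint_left.1 (disjoint_interior_extremePoints K) hxK hxE
  refine ⟨extremePoints ℝ K, hfin, ?_⟩
  rw [← (hfin.isClosed_convexHull ℝ).closure_eq]
  exact (closure_convexHull_extremePoints hKcomp hKconv).symm

end
end

section
/- Let K be a convex body in ℝ³ and let p, q, x, y ∈ K. If x lies strictly between p and q (i.e., x is a point of the open segment from p to q), and the closed line segment [x, y] lies entirely in the boundary of K, then the closed triangle with vertices p, q, y (the convex hull of {p, q, y}) lies entirely in the boundary of K. -/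
noncomputable section

/-- If `K` is a convex body in `ℝ³`, `p, q, x, y ∈ K`, `x` lies strictly between
`p` and `q`, and the segment `[x, y]` lies in the boundary of `K`, then the
triangle `conv {p, q, y}` lies in the boundary of `K`. -/
theorem triangle_subset_frontier
    (K : Set (EuclideanSpace ℝ (Fin 3)))
    (hKcomp : IsCompact K) (hKconv : Convex ℝ K) (hKint : (interior K).Nonempty)
    (p q x y : EuclideanSpace ℝ (Fin 3))
    (hp : p ∈ K) (hq : q ∈ K) (hx : x ∈ K) (hy : y ∈ K)
    (hxpq : x ∈ openSegment ℝ p q)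
    (hxy : segment ℝ x y ⊆ frontier K) :
    convexHull ℝ {p, q, y} ⊆ frontier K := by
  set m := midpoint ℝ x y
  have hm : m ∉ interior K :=
    (hxy (midpoint_mem_segment x y)).2
  -- A supporting functional at the midpoint of `[x, y]`.
  obtain ⟨f, hf⟩ := geometric_hahn_banach_open_point hKconv.interior isOpen_interior hm
  have hle : ∀ a ∈ K, f a ≤ f m := by
    have hsub : closure (interior K) ⊆ {a | f a ≤ f m} :=
      closure_minimal (fun a ha => (hf a ha).le) (isClosed_le f.continuous continuous_const)
    rw [hKconv.closure_interior_eq_closure_of_nonempty_interior hKint] at hsub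
    exact fun a ha => hsub (subset_closure ha)
  have hfm : f m = 2⁻¹ * (f x + f y) := by
    simp [m, midpoint_eq_smul_add, mul_add]
  have hfx : f x = f m := by linarith [hle x hx, hle y hy]
  have hfy : f y = f m := by linarith [hle x hx, hle y hy]
  obtain ⟨s, t, hs, ht, hst, hxst⟩ := hxpq
  have hfpq : s * f p + t * f q = f m := by
    rw [← hfx, ← hxst]
    simp
  have hsum : s * (f m - f p) + t * (f m - f q) = 0 := by
    linear_combination f m * hst - hfpq
  have hsp := mul_nonneg hs.le (sub_nonneg.2 (hle p hp))
  have htq := mul_nonneg ht.le (sub_nonneg.2 (hle q hq))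
  have hfp : f p = f m := by
    have h0 : s * (f m - f p) = 0 := by linarith
    linarith [(mul_eq_zero.1 h0).resolve_left hs.ne']
  have hfq : f q = f m := by
    have h0 : t * (f m - f q) = 0 := by linarith
    linarith [(mul_eq_zero.1 h0).resolve_left ht.ne']
  have hhull : convexHull ℝ {p, q, y} ⊆ {a | f a = f m} := by
    refine convexHull_min ?_ (convex_hyperplane f.toLinearMap.isLinear (f m))
    rintro a (rfl | rfl | rfl) <;> assumption
  have hK : convexHull ℝ {p, q, y} ⊆ K := by
    refine convexHull_min ?_ hKconv
    rintro a (rfl | rfl | rfl) <;> assumption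
  exact fun z hz => ⟨subset_closure (hK hz), fun hzi => (hf z hzi).ne (hhull hz)⟩

end
end

section
/- Let K be a convex body in ℝ³ containing the origin in its interior such that for every plane P through the origin the intersection P ∩ K is a polygon. Then for all points p, q ∈ K with p ≠ q there exists ε > 0 such that for every r ∈ K, if 0 < |p − r| < ε and the angle ∠rpq between the vectors r − p and q − p is less than ε, then r is not an extreme point of K. -/
noncomputable section

open Module

open Filter Topology

section NormedSpace

variable {E : Type*} [NormedAddCommGroup E] [NormedSpace ℝ E] {K : Set E}

theorem exists_supporting_functional (hK : Convex ℝ K) (h0 : (0 : E) ∈ interior K) {x : E}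
    (hx : x ∉ interior K) : ∃ l : StrongDual ℝ E, (∀ y ∈ K, l y ≤ 1) ∧ 1 ≤ l x := by
  obtain ⟨f, hf⟩ := geometric_hahn_banach_open_point hK.interior isOpen_interior hx
  have hpos : 0 < f x := by simpa using hf 0 h0
  refine ⟨(f x)⁻¹ • f, fun y hy => ?_, by simp [hpos.ne']⟩
  have hy' : y ∈ closure (interior K) := by
    rw [hK.closure_interior_eq_closure_of_nonempty_interior ⟨0, h0⟩]
    exact subset_closure hy
  have hle : f y ≤ f x :=
    closure_minimal (s := interior K) (t := {z | f z ≤ f x}) (fun z hz => (hf z hz).le)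
      (isClosed_le f.continuous continuous_const) hy'
  simpa [inv_mul_le_iff₀ hpos] using hle

/-- A point of `convexHull ℝ F` on the supporting hyperplane `l' = 1` is a combination of the
points of `F` on that hyperplane. -/
theorem eq_one_of_mem_convexHull {F : Set E} {l l' : StrongDual ℝ E} (hF : ∀ f ∈ F, l' f ≤ 1)
    (hll : ∀ f ∈ F, l' f = 1 → l f = 1) {x : E} (hx : x ∈ convexHull ℝ F) (hx1 : l' x = 1) :
    l x = 1 := by
  have hconv : Convex ℝ {y | l' y < 1 ∨ (l' y = 1 ∧ l y = 1)} := by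
    refine convex_iff_forall_pos.2 fun y hy z hz a b ha hb hab => ?_
    simp only [Set.mem_ofPred_eq, map_add, map_smul, smul_eq_mul] at hy hz ⊢
    rcases hy with hy | ⟨hy, hy'⟩ <;> rcases hz with hz | ⟨hz, hz'⟩
    · left; nlinarith
    · left; nlinarith
    · left; nlinarith
    · right; simp [hy, hy', hz, hz', hab]
  have hmem := convexHull_min (s := F) (fun f hf => by
    rcases (hF f hf).lt_or_eq with h | h
    · exact Or.inl h
    · exact Or.inr ⟨h, hll f hf h⟩) hconv hx
  rcases hmem with h | h
  · exact absurd hx1 h.ne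
  · exact h.2

/-- If a section of `K` is the convex hull of a finite set, then from every boundary point `m` of
the section a nondegenerate boundary segment starts on each side. -/
theorem exists_functional_eq_one_on_edge (hK : Convex ℝ K) (hKc : IsClosed K)
    (h0 : (0 : E) ∈ interior K)
    {P : Submodule ℝ E} {F : Set E} (hF : F.Finite) (hPF : (P : Set E) ∩ K = convexHull ℝ F)
    {m e : E} (hm : m ∈ P) (he : e ∈ P) (hmK : m ∈ frontier K) :
    ∃ l : StrongDual ℝ E, (∀ y ∈ K, l y ≤ 1) ∧ l m = 1 ∧
      ∃ a > (0 : ℝ), ∃ t > (0 : ℝ), a • (m + t • e) ∈ K ∧ l (a • (m + t • e)) = 1 := by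
  have hnhds : K ∈ 𝓝 (0 : E) := mem_interior_iff_mem_nhds.1 h0
  set x : ℝ → E := fun t => m + t • e with hx
  have hgm : gauge K m = 1 := (gauge_eq_one_iff_mem_frontier hK hnhds).2 hmK
  have hgc : Continuous fun t => gauge K (x t) :=
    (continuous_gauge hK hnhds).comp (by fun_prop)
  have hgt : Tendsto (fun t => gauge K (x t)) (𝓝[>] 0) (𝓝 1) := by
    have := hgc.tendsto 0
    simp only [hx, zero_smul, add_zero, hgm] at this
    exact this.mono_left nhdsWithin_le_nhds
  set xh : ℝ → E := fun t => (gauge K (x t))⁻¹ • x t with hxh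
  have hxt : Tendsto xh (𝓝[>] 0) (𝓝 m) := by
    have h1 : Tendsto x (𝓝[>] 0) (𝓝 m) := by
      have : Continuous x := by fun_prop
      have := this.tendsto 0
      simp only [hx, zero_smul, add_zero] at this
      exact this.mono_left nhdsWithin_le_nhds
    simpa using (hgt.inv₀ one_ne_zero).smul h1
  have hxP : ∀ t, xh t ∈ P := fun t =>
    P.smul_mem _ (P.add_mem hm (P.smul_mem _ he))
  have hpos : ∀ᶠ t in 𝓝[>] (0 : ℝ), 0 < gauge K (x t) := hgt.eventually_const_lt one_pos
  have hfr : ∀ t, 0 < gauge K (x t) → xh t ∈ frontier K := fun t ht => by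
    rw [← gauge_eq_one_iff_mem_frontier hK hnhds, hxh,
      gauge_smul_of_nonneg (inv_nonneg.2 ht.le), smul_eq_mul, inv_mul_cancel₀ ht.ne']
  have : Finite F := hF
  obtain ⟨S, hS⟩ : ∃ S : Set F, ∃ᶠ t in 𝓝[>] (0 : ℝ), (0 < t ∧ 0 < gauge K (x t)) ∧
      ∃ l : StrongDual ℝ E, (∀ y ∈ K, l y ≤ 1) ∧ l (xh t) = 1 ∧ S = {f : F | l f = 1} := by
    by_contra hcon
    have hcon := fun S => not_frequently.1 (not_exists.1 hcon S)
    obtain ⟨t, ht, htpos, ht0⟩ :=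
      ((eventually_all.2 hcon).and (hpos.and self_mem_nhdsWithin)).exists
    obtain ⟨l, hl, hl1⟩ := exists_supporting_functional hK h0 (hfr t htpos).2
    exact ht _ ⟨⟨ht0, htpos⟩, l, hl,
      le_antisymm (hl _ (hKc.frontier_subset (hfr t htpos))) hl1, rfl⟩
  obtain ⟨t, ⟨ht0, htpos⟩, l, hl, hl1, hlS⟩ := hS.exists
  refine ⟨l, hl, ?_, _, inv_pos.2 htpos, t, ht0, hKc.frontier_subset (hfr t htpos), hl1⟩
  have hfreq : ∃ᶠ s in 𝓝[>] (0 : ℝ), xh s ∈ {y | l y = 1} := hS.mono fun s hs => by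
    obtain ⟨⟨-, hspos⟩, l', hl', hl1', hlS'⟩ := hs
    have hFK : F ⊆ K := fun f hf => (hPF.symm ▸ subset_convexHull ℝ F hf : f ∈ (P : Set E) ∩ K).2
    refine eq_one_of_mem_convexHull (fun f hf => hl' f (hFK hf)) (fun f hf hf1 => ?_)
      (hPF ▸ ⟨hxP s, hKc.frontier_subset (hfr s hspos)⟩) hl1'
    have : (⟨f, hf⟩ : F) ∈ {f : F | l f = 1} := by
      rw [← hlS, hlS']; exact hf1
    exact this
  exact (isClosed_eq l.continuous continuous_const).mem_of_frequently_of_tendsto hfreq hxt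

theorem eq_left_of_mem_extremePoints (hK : Convex ℝ K) (h0 : (0 : E) ∈ K) {p q w r : E}
    (hp : p ∈ K) (hq : q ∈ K) (hw : w ∈ K) {a b c : ℝ} (ha : 0 < a) (hb : 0 < b) (hc : 0 ≤ c)
    (habc : a + b + c ≤ 1) (hr : r = a • p + b • q + c • w) (hext : r ∈ K.extremePoints ℝ) :
    p = r := by
  have ha1 : 0 < 1 - a := by linarith
  have hbc : 0 < b + c := by linarith
  have hz : (b / (b + c)) • q + (c / (b + c)) • w ∈ K :=
    hK hq hw (by positivity) (by positivity) (by field_simp)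
  have hy := hK.smul_mem_of_zero_mem h0 hz
    (t := (b + c) / (1 - a)) ⟨by positivity, (div_le_one ha1).2 (by linarith)⟩
  refine (mem_extremePoints_iff_left.1 hext).2 p hp _ hy
    ⟨a, 1 - a, ha, ha1, by ring, ?_⟩
  rw [hr, smul_smul, smul_add, smul_smul, smul_smul, add_assoc]
  congr 3 <;> field_simp

end NormedSpace

section InnerProductSpace

variable {V : Type*} [NormedAddCommGroup V] [InnerProductSpace ℝ V]

theorem norm_normalize_sub_normalize_le_angle {x y : V} (hx : x ≠ 0) (hy : y ≠ 0) :
    ‖‖x‖⁻¹ • x - ‖y‖⁻¹ • y‖ ≤ InnerProductGeometry.angle x y := by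
  refine abs_le_of_sq_le_sq' ?_ (InnerProductGeometry.angle_nonneg x y) |>.2
  have hx' := norm_pos_iff.2 hx
  have hy' := norm_pos_iff.2 hy
  have hcos : Real.cos (InnerProductGeometry.angle x y) = ‖x‖⁻¹ * (‖y‖⁻¹ * inner ℝ x y) := by
    rw [InnerProductGeometry.cos_angle]; field_simp
  have := Real.one_sub_sq_div_two_le_cos (x := InnerProductGeometry.angle x y)
  rw [norm_sub_sq_real, norm_smul, norm_smul, inner_smul_left, inner_smul_right]
  simp only [norm_inv, norm_norm, inv_mul_cancel₀ hx'.ne', inv_mul_cancel₀ hy'.ne',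
    RCLike.conj_to_real, ← hcos]
  linarith

/-- If the segment from `p` to `q` enters the interior of `K`, then near `p` and in directions
close to `q - p` the set `K` has no extreme points. -/
theorem notMem_extremePoints_of_midpoint_mem_interior {K : Set V} {p q : V}
    (hp : p ∈ K) (hpq : p ≠ q) (hm : midpoint ℝ p q ∈ interior K) :
    ∃ ε > 0, ∀ r ∈ K, p ≠ r → dist p r < ε →
      ‖‖r - p‖⁻¹ • (r - p) - ‖q - p‖⁻¹ • (q - p)‖ < ε → r ∉ K.extremePoints ℝ := by
  obtain ⟨η, hη, hball⟩ := Metric.mem_nhds_iff.1 (mem_interior_iff_mem_nhds.1 hm)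
  have hd : 0 < ‖q - p‖ := norm_pos_iff.2 (sub_ne_zero.2 hpq.symm)
  refine ⟨min (‖q - p‖ / 2) (η / ‖q - p‖), by positivity, fun r _ hpr hdist hang hext => ?_⟩
  have hρ : 0 < ‖r - p‖ := norm_pos_iff.2 (sub_ne_zero.2 hpr.symm)
  rw [dist_comm, dist_eq_norm] at hdist
  have h1 := hdist.trans_le (min_le_left _ _)
  have h2 := hang.trans_le (min_le_right _ _)
  have hy : p + (‖q - p‖ / 2) • (‖r - p‖⁻¹ • (r - p)) ∈ K := by
    apply hball
    rw [mem_ball_iff_norm]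
    have : p + (‖q - p‖ / 2) • (‖r - p‖⁻¹ • (r - p)) - midpoint ℝ p q =
        (‖q - p‖ / 2) • (‖r - p‖⁻¹ • (r - p) - ‖q - p‖⁻¹ • (q - p)) := by
      have h : (‖q - p‖ / 2) • (‖q - p‖⁻¹ • (q - p)) = (1 / 2 : ℝ) • (q - p) := by
        rw [smul_smul]; congr 1; field_simp
      rw [smul_sub (‖q - p‖ / 2), h, midpoint_eq_smul_add, invOf_eq_inv]
      module
    rw [this, norm_smul, Real.norm_of_nonneg (by positivity)]
    rw [lt_div_iff₀ hd] at h2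
    nlinarith
  refine hpr ((mem_extremePoints_iff_left.1 hext).2 p hp _ hy
    ⟨1 - ‖r - p‖ / (‖q - p‖ / 2), ‖r - p‖ / (‖q - p‖ / 2), ?_, by positivity, by ring, ?_⟩)
  · rw [sub_pos, div_lt_one (by positivity)]; exact h1
  · have h : (‖r - p‖ / (‖q - p‖ / 2)) • (‖q - p‖ / 2) • (‖r - p‖⁻¹ • (r - p)) = r - p := by
      rw [smul_smul, smul_smul]
      convert one_smul ℝ (r - p) using 2
      field_simp
    rw [smul_add, h]
    module

/-- If the triangle `p q w` lies in a supporting plane of `K`, then on the side of `w` the set `K`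
has no extreme points near `p` in directions close to `q - p`. -/
theorem notMem_extremePoints_of_triangle {K : Set V} (hV : finrank ℝ V = 3)
    (hK : Convex ℝ K) (h0 : (0 : V) ∈ K) {p q w : V} (hp : p ∈ K) (hq : q ∈ K) (hw : w ∈ K)
    (hpq : p ≠ q) {l : StrongDual ℝ V} (hl : ∀ y ∈ K, l y ≤ 1) (hlp : l p = 1) (hlq : l q = 1)
    (hlw : l w = 1) {φ : V →ₗ[ℝ] ℝ} (hφp : φ p = 0) (hφq : φ q = 0) (hφw : φ w ≠ 0) :
    ∃ ε > 0, ∀ r ∈ K, p ≠ r → dist p r < ε →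
      ‖‖r - p‖⁻¹ • (r - p) - ‖q - p‖⁻¹ • (q - p)‖ < ε → 0 ≤ φ r * φ w →
        r ∉ K.extremePoints ℝ := by
  have : FiniteDimensional ℝ V := Module.finite_of_finrank_pos (by omega)
  have hli : LinearIndependent ℝ ![p, q, w] := by
    rw [Fintype.linearIndependent_iff]
    intro g hg
    simp only [Fin.sum_univ_three, Matrix.cons_val_zero, Matrix.cons_val_one,
      Matrix.cons_val_two] at hg
    have h2 : g 2 = 0 := by
      have := congrArg φ hg
      simpa [hφp, hφq, hφw] using this
    have h01 : g 0 + g 1 = 0 := by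
      have := congrArg l hg
      simpa [hlp, hlq, h2] using this
    have h1 : g 1 = 0 := by
      have h : g 1 • (q - p) = 0 := by
        rw [eq_neg_of_add_eq_zero_left h01, h2] at hg
        rw [← hg]; module
      exact (smul_eq_zero.1 h).resolve_right (sub_ne_zero.2 hpq.symm)
    intro i
    fin_cases i
    · simpa [h1] using h01
    · exact h1
    · exact h2
  let B := basisOfLinearIndependentOfCardEqFinrank hli (by simp [hV])
  have hB : ⇑B = ![p, q, w] := coe_basisOfLinearIndependentOfCardEqFinrank hli _
  have hB0 : B 0 = p := by simp [hB]
  have hB1 : B 1 = q := by simp [hB]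
  have hB2 : B 2 = w := by simp [hB]
  let α : V →L[ℝ] ℝ := LinearMap.toContinuousLinearMap (B.coord 0)
  let β : V →L[ℝ] ℝ := LinearMap.toContinuousLinearMap (B.coord 1)
  have hαp : α p = 1 := by simp [α, ← hB0]
  have hβp : β p = 0 := by simp [β, ← hB0]
  have hβq : β q = 1 := by simp [β, ← hB1]
  have hd : 0 < ‖q - p‖ := norm_pos_iff.2 (sub_ne_zero.2 hpq.symm)
  obtain ⟨ε₁, hε₁, h₁⟩ := Metric.isOpen_iff.1 (isOpen_lt continuous_const α.continuous) p
    (show (0 : ℝ) < α p by simp [hαp])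
  obtain ⟨ε₂, hε₂, h₂⟩ := Metric.isOpen_iff.1 (isOpen_lt continuous_const β.continuous)
    (‖q - p‖⁻¹ • (q - p))
    (show (0 : ℝ) < β (‖q - p‖⁻¹ • (q - p)) by simp [hβp, hβq, -norm_pos_iff, hd])
  refine ⟨min ε₁ ε₂, lt_min hε₁ hε₂, fun r hr hpr hdist hang hφr hext => hpr ?_⟩
  have hρ : 0 < ‖r - p‖ := norm_pos_iff.2 (sub_ne_zero.2 hpr.symm)
  have hαr : 0 < α r := h₁ (by
    rw [Metric.mem_ball, dist_comm]; exact hdist.trans_le (min_le_left _ _))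
  have hβr : 0 < β r := by
    have : 0 < β (‖r - p‖⁻¹ • (r - p)) := h₂ (by
      rw [mem_ball_iff_norm]; exact hang.trans_le (min_le_right _ _))
    rw [map_smul, map_sub, hβp, sub_zero, smul_eq_mul] at this
    exact pos_of_mul_pos_right this (inv_nonneg.2 hρ.le)
  have hsum : r = α r • p + β r • q + B.coord 2 r • w := by
    have := B.sum_repr r
    rw [Fin.sum_univ_three, hB0, hB1, hB2] at this
    exact this.symm
  have hγ : 0 ≤ B.coord 2 r := by
    have h : φ r = B.coord 2 r * φ w := by
      conv_lhs => rw [hsum]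
      simp only [map_add, map_smul, hφp, hφq, smul_eq_mul]; ring
    rw [h, mul_assoc] at hφr
    exact nonneg_of_mul_nonneg_left hφr (mul_self_pos.2 hφw)
  have hle : α r + β r + B.coord 2 r ≤ 1 := by
    have h : l r = α r + β r + B.coord 2 r := by
      conv_lhs => rw [hsum]
      simp only [map_add, map_smul, hlp, hlq, hlw, smul_eq_mul]; ring
    rw [← h]; exact hl r hr
  exact eq_left_of_mem_extremePoints hK h0 hp hq hw hαr hβr hγ hle hsum hext

/-- Version of `notMem_extremePoints_of_triangle` where the triangle comes from a plane section
through the midpoint of `p` and `q` that is the convex hull of a finite set. -/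
theorem notMem_extremePoints_of_section {K : Set V} (hV : finrank ℝ V = 3)
    (hK : Convex ℝ K) (hKc : IsClosed K) (h0 : (0 : V) ∈ interior K) {p q : V} (hp : p ∈ K)
    (hq : q ∈ K) (hpq : p ≠ q) (hm : midpoint ℝ p q ∈ frontier K) {φ : V →ₗ[ℝ] ℝ}
    (hφp : φ p = 0) (hφq : φ q = 0) {e : V} (hφe : φ e ≠ 0) {P : Submodule ℝ V} {F : Set V}
    (hF : F.Finite) (hPF : (P : Set V) ∩ K = convexHull ℝ F) (hmP : midpoint ℝ p q ∈ P)
    (heP : e ∈ P) :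
    ∃ ε > 0, ∀ r ∈ K, p ≠ r → dist p r < ε →
      ‖‖r - p‖⁻¹ • (r - p) - ‖q - p‖⁻¹ • (q - p)‖ < ε → 0 ≤ φ r * φ e →
        r ∉ K.extremePoints ℝ := by
  obtain ⟨l, hl, hlm, a, ha, t, ht, hwK, hlw⟩ :=
    exists_functional_eq_one_on_edge hK hKc h0 hF hPF hmP heP hm
  have hlp := hl p hp
  have hlq := hl q hq
  have hφw : φ (a • (midpoint ℝ p q + t • e)) = a * t * φ e := by
    simp [midpoint_eq_smul_add, hφp, hφq, mul_assoc]
  have hlpq : l p + l q = 2 := by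
    rw [midpoint_eq_smul_add, map_smul, map_add, invOf_eq_inv, smul_eq_mul] at hlm
    linarith
  obtain ⟨ε, hε, h⟩ := notMem_extremePoints_of_triangle hV hK (interior_subset h0) hp hq hwK hpq
    hl (by linarith) (by linarith) hlw hφp hφq (by rw [hφw]; positivity)
  refine ⟨ε, hε, fun r hr hpr hd ha' hφr => h r hr hpr hd ha' ?_⟩
  rw [hφw, mul_left_comm]
  positivity

end InnerProductSpace

/-- Let `K` be a convex body in `ℝ³` with the origin in its interior, all of
whose sections by planes through the origin are polygons.  Then for all
`p, q ∈ K` with `p ≠ q` there is `ε > 0` such that every `r ∈ K` with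
`0 < |p - r| < ε` and `∠ r p q < ε` is not an extreme point of `K`. -/
theorem no_extreme_points_near
    (K : Set (EuclideanSpace ℝ (Fin 3)))
    (hKcomp : IsCompact K) (hKconv : Convex ℝ K) (hKint : (interior K).Nonempty)
    (h0 : (0 : EuclideanSpace ℝ (Fin 3)) ∈ interior K)
    (hsec : ∀ P : Submodule ℝ (EuclideanSpace ℝ (Fin 3)), finrank ℝ P = 2 →
      IsPolygon ((P : Set (EuclideanSpace ℝ (Fin 3))) ∩ K))
    (p q : EuclideanSpace ℝ (Fin 3)) (hp : p ∈ K) (hq : q ∈ K) (hpq : p ≠ q) :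
    ∃ ε > 0, ∀ r ∈ K, 0 < dist p r → dist p r < ε →
      EuclideanGeometry.angle r p q < ε → r ∉ K.extremePoints ℝ := by
  have hV : finrank ℝ (EuclideanSpace ℝ (Fin 3)) = 3 := by simp
  suffices h : ∃ ε > 0, ∀ r ∈ K, p ≠ r → dist p r < ε →
      ‖‖r - p‖⁻¹ • (r - p) - ‖q - p‖⁻¹ • (q - p)‖ < ε → r ∉ K.extremePoints ℝ by
    obtain ⟨ε, hε, h⟩ := h
    refine ⟨ε, hε, fun r hr hpr hd hang => h r hr (dist_pos.1 hpr) hd (lt_of_le_of_lt ?_ hang)⟩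
    exact norm_normalize_sub_normalize_le_angle (sub_ne_zero.2 (dist_pos.1 hpr).symm)
      (sub_ne_zero.2 hpq.symm)
  by_cases hm : midpoint ℝ p q ∈ interior K
  · exact notMem_extremePoints_of_midpoint_mem_interior hp hpq hm
  have hmK : midpoint ℝ p q ∈ K := hKconv.midpoint_mem hp hq
  have hmf : midpoint ℝ p q ∈ frontier K := ⟨subset_closure hmK, hm⟩
  have hlt : Submodule.span ℝ {p, q} < ⊤ := by
    refine lt_top_iff_ne_top.2 fun htop => ?_
    have h2 : finrank ℝ (Submodule.span ℝ {p, q}) ≤ 2 := by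
      have := finrank_span_finset_le_card (R := ℝ) ({p, q} : Finset (EuclideanSpace ℝ (Fin 3)))
      rw [Finset.coe_pair] at this
      exact this.trans Finset.card_le_two
    rw [htop, finrank_top, hV] at h2
    omega
  obtain ⟨φ, hφ, hφker⟩ := Submodule.exists_le_ker_of_lt_top _ hlt
  have hφp : φ p = 0 := hφker (Submodule.subset_span (by simp))
  have hφq : φ q = 0 := hφker (Submodule.subset_span (by simp))
  obtain ⟨e, he⟩ : ∃ e, φ e ≠ 0 := by
    by_contra! h
    exact hφ (LinearMap.ext h)
  have hm0 : midpoint ℝ p q ≠ 0 := fun h => hm (h ▸ h0)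
  have hφm : φ (midpoint ℝ p q) = 0 := by simp [midpoint_eq_smul_add, hφp, hφq]
  have hli : LinearIndependent ℝ ![midpoint ℝ p q, e] := by
    rw [LinearIndependent.pair_iff]
    intro s t hst
    have ht : t = 0 := by
      have := congrArg φ hst
      simpa [hφm, he] using this
    simpa [ht, hm0] using hst
  have hfin := finrank_span_eq_card hli
  rw [Fintype.card_fin] at hfin
  obtain ⟨-, -, -, F, hF, hPF⟩ := hsec _ hfin
  have hmP : midpoint ℝ p q ∈ Submodule.span ℝ (Set.range ![midpoint ℝ p q, e]) :=
    Submodule.subset_span ⟨0, rfl⟩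
  have heP : e ∈ Submodule.span ℝ (Set.range ![midpoint ℝ p q, e]) :=
    Submodule.subset_span ⟨1, rfl⟩
  obtain ⟨ε₁, hε₁, h₁⟩ := notMem_extremePoints_of_section hV hKconv hKcomp.isClosed h0 hp hq hpq
    hmf hφp hφq he hF hPF hmP heP
  obtain ⟨ε₂, hε₂, h₂⟩ := notMem_extremePoints_of_section hV hKconv hKcomp.isClosed h0 hp hq hpq
    hmf hφp hφq (e := -e) (by simpa using he) hF hPF hmP (neg_mem heP)
  refine ⟨min ε₁ ε₂, lt_min hε₁ hε₂, fun r hr hpr hd ha => ?_⟩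
  rcases le_total 0 (φ r * φ e) with h | h
  · exact h₁ r hr hpr (hd.trans_le (min_le_left _ _)) (ha.trans_le (min_le_left _ _)) h
  · exact h₂ r hr hpr (hd.trans_le (min_le_right _ _)) (ha.trans_le (min_le_right _ _))
      (by simpa using h)

end
end

section
/- Let K be a convex body in ℝ³ containing the origin in its interior such that for every plane P through the origin the intersection P ∩ K is a polygon. Then the set of extreme points of K is finite. -/
noncomputable section

open Module

open Filter Topology in
/-- From an interior point one can move a little in any direction inside the set. -/
theorem exists_pos_add_smul_mem_of_mem_interior {E : Type*} [NormedAddCommGroup E]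
    [NormedSpace ℝ E] {K : Set E} {z : E} (hz : z ∈ interior K) (v : E) :
    ∃ ε : ℝ, 0 < ε ∧ z + ε • v ∈ K := by
  have h : Tendsto (fun ε : ℝ => z + ε • v) (𝓝[>] 0) (𝓝 z) := by
    have : Continuous (fun ε : ℝ => z + ε • v) := by fun_prop
    simpa using (this.tendsto 0).mono_left nhdsWithin_le_nhds
  obtain ⟨ε, hε, h0⟩ :=
    ((h.eventually (mem_interior_iff_mem_nhds.1 hz)).and self_mem_nhdsWithin).exists
  exact ⟨ε, h0, hε⟩

/-- A non-interior point of a convex set with the origin in its interior lies on a supporting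
hyperplane, normalized to have value one. -/
theorem Convex.exists_support_eq_one {E : Type*} [NormedAddCommGroup E]
    [NormedSpace ℝ E] {K : Set E} (hK : Convex ℝ K) (h0 : (0 : E) ∈ interior K) {m : E}
    (hm : m ∉ interior K) : ∃ f : E →L[ℝ] ℝ, f m = 1 ∧ ∀ z ∈ K, f z ≤ 1 := by
  obtain ⟨f, hf⟩ := geometric_hahn_banach_open_point hK.interior isOpen_interior hm
  have hpos : 0 < f m := by simpa using hf 0 h0
  have hle : ∀ z ∈ K, f z ≤ f m := by
    intro z hz
    have hz' : z ∈ closure (interior K) := by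
      rw [hK.closure_interior_eq_closure_of_nonempty_interior ⟨0, h0⟩]
      exact subset_closure hz
    exact closure_minimal (fun a ha => (hf a ha).le)
      (isClosed_le f.continuous continuous_const) hz'
  refine ⟨(f m)⁻¹ • f, by simp [hpos.ne'], fun z hz => ?_⟩
  have := hle z hz
  simp only [smul_apply, smul_eq_mul]
  rw [inv_mul_le_iff₀ hpos]
  simpa using this

/-- If a planar section of a convex set is a polygon, then from any boundary point `x` in the
section an edge of the polygon starts into the half-plane on the side of `w`. -/
theorem exists_edge_of_section {E : Type*} [NormedAddCommGroup E]
    [NormedSpace ℝ E] {K : Set E} (hK : Convex ℝ K) (h0 : (0 : E) ∈ interior K) {x w : E}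
    (hx : x ∉ interior K) (A B : E →L[ℝ] ℝ) (hAx : A x = 1) (hAw : A w = 0)
    (hBx : B x = 0) (hBw : B w = 1) {F : Set E} (hF : F.Finite)
    (hsec : (Submodule.span ℝ {x, w} : Set E) ∩ K = convexHull ℝ F) :
    ∃ a b : ℝ, 0 < b ∧ a • x + b • w ∈ K ∧
      (1 / 2 : ℝ) • x + (1 / 2 : ℝ) • (a • x + b • w) ∉ interior K := by
  obtain ⟨f, hfx, hf⟩ := hK.exists_support_eq_one h0 hx
  have hcoord : ∀ z ∈ F, z ∈ K ∧ z = A z • x + B z • w := by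
    intro z hz
    have hz' : z ∈ (Submodule.span ℝ {x, w} : Set E) ∩ K := hsec ▸ subset_convexHull ℝ F hz
    obtain ⟨hzP, hzK⟩ := hz'
    obtain ⟨a, b, rfl⟩ := Submodule.mem_span_pair.1 hzP
    exact ⟨hzK, by simp [hAx, hAw, hBx, hBw]⟩
  have hne : {z ∈ F | 0 < B z}.Nonempty := by
    by_contra hempty
    have hle : ∀ z ∈ F, B z ≤ 0 := by
      intro z hz
      by_contra hlt
      exact hempty ⟨z, hz, not_le.1 hlt⟩
    have hsub : convexHull ℝ F ⊆ {z | B z ≤ 0} :=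
      convexHull_min hle (convex_halfSpace_le B.isLinear 0)
    obtain ⟨ε, hε, hεK⟩ := exists_pos_add_smul_mem_of_mem_interior h0 w
    rw [zero_add] at hεK
    have hmem : ε • w ∈ convexHull ℝ F := by
      rw [← hsec]
      exact ⟨Submodule.smul_mem _ _ (Submodule.subset_span (by simp)), hεK⟩
    have : B (ε • w) ≤ 0 := hsub hmem
    simp [hBw] at this
    linarith
  obtain ⟨y, ⟨hyF, hyB⟩, hmax⟩ := Set.exists_max_image {z ∈ F | 0 < B z}
    (fun z => (A z - 1) / B z) (hF.subset (Set.sep_subset _ _)) hne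
  obtain ⟨hyK, hy⟩ := hcoord y hyF
  have hbound : ∀ z ∈ F, B y * A z - (A y - 1) * B z ≤ B y := by
    intro z hz
    obtain ⟨hzK, hzc⟩ := hcoord z hz
    rcases lt_or_ge 0 (B z) with hpos | hneg
    · have := hmax z ⟨hz, hpos⟩
      rw [div_le_div_iff₀ hpos hyB] at this
      linarith
    · have e1 : f z = A z + B z * f w := by
        conv_lhs => rw [hzc]
        simp [hfx]
      have e2 : f y = A y + B y * f w := by
        conv_lhs => rw [hy]
        simp [hfx]
      have h1 := mul_le_mul_of_nonneg_left (hf z hzK) hyB.le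
      have h2 := mul_le_mul_of_nonneg_left (hf y hyK) (neg_nonneg.2 hneg)
      rw [e1] at h1
      rw [e2] at h2
      linarith
  have hsub : convexHull ℝ F ⊆ {z | (B y • A - (A y - 1) • B) z ≤ B y} :=
    convexHull_min (fun z hz => by simpa using hbound z hz)
      (convex_halfSpace_le (B y • A - (A y - 1) • B).isLinear _)
  refine ⟨A y, B y, hyB, hy ▸ hyK, fun hint => ?_⟩
  rw [← hy] at hint
  obtain ⟨ε, hε, hεK⟩ := exists_pos_add_smul_mem_of_mem_interior hint
    ((1 / 2 : ℝ) • x + (1 / 2 : ℝ) • y)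
  have hyP : y ∈ Submodule.span ℝ {x, w} :=
    Submodule.mem_span_pair.2 ⟨_, _, hy.symm⟩
  have hxP : x ∈ Submodule.span ℝ {x, w} := Submodule.subset_span (by simp)
  have hmP := Submodule.add_mem _ (Submodule.smul_mem _ (1 / 2 : ℝ) hxP)
    (Submodule.smul_mem _ (1 / 2 : ℝ) hyP)
  have hmem := hsec.subset ⟨Submodule.add_mem _ hmP (Submodule.smul_mem _ ε hmP), hεK⟩
  have := hsub hmem
  simp [hAx, hBx] at this
  nlinarith [mul_pos hε hyB]

/-- A point in the cone over a triangle `x, y, q` contained in a face of `K` is not an extreme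
point, provided that it does not lie on the rays through `x`, `y` or `q`. -/
theorem notMem_extremePoints_of_cone {E : Type*} [NormedAddCommGroup E]
    [NormedSpace ℝ E] {K : Set E} (hK : Convex ℝ K) (h0 : (0 : E) ∈ K) {x y q : E}
    (hx : x ∈ K) (hy : y ∈ K) (hq : q ∈ K) (f : E →L[ℝ] ℝ) (hfx : f x = 1) (hfy : f y = 1)
    (hfq : f q = 1) (hf : ∀ z ∈ K, f z ≤ 1) {a b c : ℝ} (ha : 0 < a) (hb : 0 < b) (hc : 0 ≤ c)
    (hne : a • x + b • y + c • q ≠ x) :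
    a • x + b • y + c • q ∉ K.extremePoints ℝ := by
  intro hz
  rw [mem_extremePoints_iff_left] at hz
  obtain ⟨hzK, hz⟩ := hz
  have hfz : f (a • x + b • y + c • q) = a + b + c := by simp [hfx, hfy, hfq]
  have hS : a + b + c ≤ 1 := hfz ▸ hf _ hzK
  have hbc : 0 < b + c := by linarith
  have hrK : (b / (b + c)) • y + (c / (b + c)) • q ∈ K :=
    hK hy hq (by positivity) (by positivity) (by field_simp)
  rcases hS.lt_or_eq with hlt | heq
  · have hsum : 0 < a + b + c := by linarith
    have hK' : (a / (a + b + c)) • x +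
        ((b + c) / (a + b + c)) • ((b / (b + c)) • y + (c / (b + c)) • q) ∈ K :=
      hK hx hrK (by positivity) (by positivity) (by field_simp; ring)
    have h := hz 0 h0 _ hK' ⟨1 - (a + b + c), a + b + c, by linarith, hsum, by ring, by
      match_scalars <;> field_simp⟩
    have := congrArg f h
    rw [hfz, map_zero] at this
    linarith
  · exact hne (hz x hx _ hrK ⟨a, b + c, ha, hbc, by linarith, by
      match_scalars <;> field_simp⟩).symm

open Filter Topology in
/-- Near a boundary point `x`, no extreme point lies in a thin wedge about the half-plane through
`x` in direction `u`, on the side of `w`. -/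
theorem eventually_notMem_extremePoints_wedge {E : Type*} [NormedAddCommGroup E]
    [NormedSpace ℝ E] {K : Set E} (hK : Convex ℝ K) (h0 : (0 : E) ∈ interior K)
    (hsec : ∀ P : Submodule ℝ E, finrank ℝ P = 2 →
      ∃ F : Set E, F.Finite ∧ (P : Set E) ∩ K = convexHull ℝ F)
    {x u w : E} (hx : x ∉ interior K) (hxK : x ∈ K) (X Y Z : E →L[ℝ] ℝ)
    (hXx : X x = 1) (hXu : X u = 0) (hYx : Y x = 0) (hYu : Y u = 1)
    (hYw : Y w = 0) (hZx : Z x = 0) (hZu : Z u = 0) (hZw : Z w = 1)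
    (hXYZ : ∀ z, z = X z • x + Y z • u + Z z • w) :
    ∃ C : ℝ, ∀ᶠ z in 𝓝 x, 0 ≤ Z z → 0 < Y z → C * Z z < Y z → z ∉ K.extremePoints ℝ := by
  have hplane : ∀ (v v' : E) (A B : E →L[ℝ] ℝ), A v = 1 → A v' = 0 → B v = 0 → B v' = 1 →
      finrank ℝ (Submodule.span ℝ {v, v'}) = 2 := by
    intro v v' A B hAv hAv' hBv hBv'
    have hli : LinearIndependent ℝ ![v, v'] := by
      rw [LinearIndependent.pair_iff]
      intro s t hst
      exact ⟨by simpa [hAv, hAv'] using congrArg A hst, by simpa [hBv, hBv'] using congrArg B hst⟩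
    have h := finrank_span_eq_card hli
    rwa [Matrix.range_cons_cons_empty, Fintype.card_fin] at h
  obtain ⟨F, hF, hFK⟩ := hsec _ (hplane x u X Y hXx hXu hYx hYu)
  obtain ⟨a, b, hb, hyK, hp⟩ := exists_edge_of_section hK h0 hx X Y hXx hXu hYx hYu hF hFK
  set y := a • x + b • u with hy
  set p := (1 / 2 : ℝ) • x + (1 / 2 : ℝ) • y with hpdef
  have hYp : (2 / b) * Y p = 1 := by
    simp [hpdef, hy, hYx, hYu]
    field_simp
  have hZp : Z p = 0 := by simp [hpdef, hy, hZx, hZu]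
  have hA1 : ((2 / b) • Y) p = 1 := by simpa using hYp
  have hA2 : ((2 / b) • Y) w = 0 := by simp [hYw]
  obtain ⟨G, hG, hGK⟩ := hsec _ (hplane p w _ Z hA1 hA2 hZp hZw)
  obtain ⟨c, d, hd, hqK, hm⟩ := exists_edge_of_section hK h0 hp _ Z hA1 hA2 hZp hZw hG hGK
  set q := c • p + d • w with hq
  obtain ⟨f, hfm, hf⟩ := hK.exists_support_eq_one h0 hm
  have hfp : f p = (f x + f y) / 2 := by simp [hpdef]; ring
  have hfm' : (f p + f q) / 2 = 1 := by rw [← hfm]; simp; ring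
  have hfx1 := hf x hxK
  have hfy1 := hf y hyK
  have hfq1 := hf q hqK
  have hfx : f x = 1 := by linarith
  have hfy : f y = 1 := by linarith
  have hfq : f q = 1 := by linarith
  have hlim : ∀ᶠ z in 𝓝 x, 0 < X z - Y z * a / b - Z z * c / (2 * d) := by
    have hcont : Continuous fun z => X z - Y z * a / b - Z z * c / (2 * d) := by fun_prop
    apply (hcont.tendsto x).eventually
    simp only [hXx, hYx, hZx]
    exact lt_mem_nhds (by norm_num)
  refine ⟨b * c / (2 * d), hlim.mono fun z hz hZ hY hYZ => ?_⟩
  have hzc : z = (X z - Y z * a / b - Z z * c / (2 * d)) • x +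
      (Y z / b - Z z * c / (2 * d)) • y + (Z z / d) • q := by
    conv_lhs => rw [hXYZ z]
    rw [hq, hpdef, hy]
    match_scalars <;> field_simp <;> ring
  have hcy : 0 < Y z / b - Z z * c / (2 * d) := by
    have : Y z / b - Z z * c / (2 * d) = (Y z - b * c / (2 * d) * Z z) / b := by
      field_simp
    rw [this]
    exact div_pos (by linarith) hb
  have hne : z ≠ x := by
    rintro rfl
    linarith
  rw [hzc] at hne ⊢
  exact notMem_extremePoints_of_cone hK (interior_subset h0) hxK hyK hqK f hfx hfy hfq hf hz hcy
    (div_nonneg hZ hd.le) hne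

open Filter Topology in
/-- Extreme points do not accumulate along a direction `u` at a boundary point `x`. -/
theorem not_tendsto_direction_extremePoints {E : Type*} [NormedAddCommGroup E]
    [NormedSpace ℝ E] {K : Set E} (hK : Convex ℝ K) (h0 : (0 : E) ∈ interior K)
    (hsec : ∀ P : Submodule ℝ E, finrank ℝ P = 2 →
      ∃ F : Set E, F.Finite ∧ (P : Set E) ∩ K = convexHull ℝ F)
    {x u w : E} (hx : x ∉ interior K) (hxK : x ∈ K) (X Y Z : E →L[ℝ] ℝ)
    (hXx : X x = 1) (hXu : X u = 0) (hYx : Y x = 0) (hYu : Y u = 1)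
    (hYw : Y w = 0) (hZx : Z x = 0) (hZu : Z u = 0) (hZw : Z w = 1)
    (hXYZ : ∀ z, z = X z • x + Y z • u + Z z • w) (U : Ultrafilter E) (hUx : ↑U ≤ 𝓝 x)
    (hUK : ∀ᶠ z in U, z ∈ K.extremePoints ℝ) (r : E → ℝ) (hr : ∀ᶠ z in U, 0 < r z)
    (hdir : Tendsto (fun z => r z • (z - X z • x)) U (𝓝 u)) : False := by
  have hY : Tendsto (fun z => r z * Y z) U (𝓝 1) := by
    have := (Y.continuous.tendsto u).comp hdir
    simpa [Function.comp_def, hYx, hYu] using this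
  have hZ : Tendsto (fun z => r z * Z z) U (𝓝 0) := by
    have := (Z.continuous.tendsto u).comp hdir
    simpa [Function.comp_def, hZx, hZu] using this
  have hYpos : ∀ᶠ z in U, 0 < Y z := by
    filter_upwards [hY.eventually (lt_mem_nhds zero_lt_one), hr] with z h1 h2
    exact (mul_pos_iff_of_pos_left h2).1 h1
  have hYZ : ∀ C : ℝ, ∀ᶠ z in U, C * Z z < Y z := by
    intro C
    have hCZ : Tendsto (fun z => C * (r z * Z z)) U (𝓝 0) := by
      simpa using hZ.const_mul C
    filter_upwards [hCZ.eventually_lt hY zero_lt_one, hr] with z h1 h2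
    refine lt_of_mul_lt_mul_left ?_ h2.le
    linarith
  have hsign : ∀ᶠ z in U, 0 ≤ Z z ∨ 0 ≤ (-Z) z :=
    Eventually.of_forall fun z => by simpa using le_total 0 (Z z)
  rcases Ultrafilter.eventually_or.1 hsign with hs | hs
  · obtain ⟨C, hC⟩ := eventually_notMem_extremePoints_wedge hK h0 hsec hx hxK X Y Z hXx hXu
      hYx hYu hYw hZx hZu hZw hXYZ
    obtain ⟨z, h1, h2, h3, h4, h5⟩ :=
      ((hC.filter_mono hUx).and (hs.and (hYpos.and ((hYZ C).and hUK)))).exists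
    exact h1 h2 h3 h4 h5
  · obtain ⟨C, hC⟩ := eventually_notMem_extremePoints_wedge (w := -w) hK h0 hsec hx hxK X Y (-Z)
      hXx hXu hYx hYu (by simp [hYw]) (by simp [hZx]) (by simp [hZu])
      (by simp [hZw]) (fun z => by simpa using hXYZ z)
    obtain ⟨z, h1, h2, h3, h4, h5⟩ :=
      ((hC.filter_mono hUx).and (hs.and (hYpos.and ((hYZ (-C)).and hUK)))).exists
    exact h1 h2 h3 (by simpa using h4) h5

/-- An extreme point that is a positive multiple of a boundary point is that point. -/
theorem eq_of_smul_mem_extremePoints {E : Type*} [NormedAddCommGroup E]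
    [NormedSpace ℝ E] {K : Set E} (hK : Convex ℝ K) (h0 : (0 : E) ∈ interior K) {x : E}
    (hx : x ∉ interior K) (hxK : x ∈ K) {t : ℝ} (ht : 0 < t)
    (h : t • x ∈ K.extremePoints ℝ) : t • x = x := by
  obtain ⟨f, hfx, hf⟩ := hK.exists_support_eq_one h0 hx
  have ht1 : t ≤ 1 := by simpa [hfx] using hf _ h.1
  rcases ht1.lt_or_eq with hlt | rfl
  · exact ((mem_extremePoints.1 h).2 0 (interior_subset h0) x hxK
      ⟨1 - t, t, by linarith, ht, by ring, by simp⟩).2.symm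
  · simp

open Filter Topology in
/-- Let `K` be a convex body in `ℝ³` with the origin in its interior, all of
whose sections by planes through the origin are polygons.  Then `K` has only
finitely many extreme points. -/
theorem finite_extreme_points
    (K : Set (EuclideanSpace ℝ (Fin 3)))
    (hKcomp : IsCompact K) (hKconv : Convex ℝ K) (hKint : (interior K).Nonempty)
    (h0 : (0 : EuclideanSpace ℝ (Fin 3)) ∈ interior K)
    (hsec : ∀ P : Submodule ℝ (EuclideanSpace ℝ (Fin 3)), finrank ℝ P = 2 →
      IsPolygon ((P : Set (EuclideanSpace ℝ (Fin 3))) ∩ K)) :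
    (K.extremePoints ℝ).Finite := by
  by_contra hinf
  obtain ⟨x, hxK, hacc⟩ := Set.Infinite.exists_accPt_of_subset_isCompact hinf hKcomp
    extremePoints_subset
  have : (𝓝[≠] x ⊓ 𝓟 (K.extremePoints ℝ)).NeBot := hacc
  set U := Ultrafilter.of (𝓝[≠] x ⊓ 𝓟 (K.extremePoints ℝ))
  have hU : ↑U ≤ 𝓝[≠] x ⊓ 𝓟 (K.extremePoints ℝ) := Ultrafilter.of_le _
  have hUx : ↑U ≤ 𝓝 x := hU.trans (inf_le_left.trans nhdsWithin_le_nhds)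
  have hUne : ∀ᶠ z in U, z ≠ x := hU.trans inf_le_left self_mem_nhdsWithin
  have hUK : ∀ᶠ z in U, z ∈ K.extremePoints ℝ := hU.trans inf_le_right (mem_principal_self _)
  have hx : x ∉ interior K := by
    intro hxi
    have hUi : ∀ᶠ z in U, z ∈ interior K := hUx (isOpen_interior.mem_nhds hxi)
    obtain ⟨z, hz1, hz2⟩ := (hUi.and hUK).exists
    exact Set.disjoint_left.1 (disjoint_interior_extremePoints K) hz1 hz2
  have hx0 : x ≠ 0 := by
    rintro rfl
    exact hx h0
  let dual : EuclideanSpace ℝ (Fin 3) → EuclideanSpace ℝ (Fin 3) →L[ℝ] ℝ :=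
    fun v => (inner ℝ v v)⁻¹ • innerSL ℝ v
  have hdual : ∀ v z, dual v z = (inner ℝ v v)⁻¹ * inner ℝ v z := fun v z => by simp [dual]
  have hdual1 : ∀ v, v ≠ 0 → dual v v = 1 := fun v hv => by
    rw [hdual, inv_mul_cancel₀ (inner_self_ne_zero.2 hv)]
  have hdual0 : ∀ v z, inner ℝ v z = 0 → dual v z = 0 := fun v z h => by rw [hdual, h, mul_zero]
  set X := dual x with hX
  have hXx : X x = 1 := hdual1 x hx0
  have hXpos : ∀ᶠ z in U, 0 < X z :=
    hUx ((X.continuous.tendsto x).eventually (lt_mem_nhds (by rw [hXx]; exact one_pos)))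
  have hrne : ∀ᶠ z in U, z - X z • x ≠ 0 := by
    filter_upwards [hUne, hUK, hXpos] with z h1 h2 h3 h4
    rw [sub_eq_zero] at h4
    rw [h4] at h2
    exact h1 (h4.trans (eq_of_smul_mem_extremePoints hKconv h0 hx hxK h3 h2))
  obtain ⟨u, hu, hUu⟩ := (isCompact_sphere (0 : EuclideanSpace ℝ (Fin 3)) 1).ultrafilter_le_nhds
    (U.map fun z => ‖z - X z • x‖⁻¹ • (z - X z • x)) (by
      rw [le_principal_iff, Ultrafilter.coe_map, mem_map]
      filter_upwards [hrne] with z hz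
      simp [norm_smul, hz])
  have hdir : Tendsto (fun z => ‖z - X z • x‖⁻¹ • (z - X z • x)) U (𝓝 u) := hUu
  have hu0 : u ≠ 0 := by
    rintro rfl
    simp at hu
  have hXu : X u = 0 := by
    have h := (X.continuous.tendsto u).comp hdir
    refine tendsto_nhds_unique h ?_
    simp [Function.comp_def, hXx]
  have hxu : inner ℝ x u = 0 := by
    rw [hX, hdual] at hXu
    exact (mul_eq_zero.1 hXu).resolve_left (inv_ne_zero (inner_self_ne_zero.2 hx0))
  obtain ⟨w, hw, hw0⟩ : ∃ w ∈ (Submodule.span ℝ {x, u})ᗮ, w ≠ 0 := by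
    apply Submodule.exists_mem_ne_zero_of_ne_bot
    intro hbot
    have h1 := (Submodule.span ℝ {x, u}).finrank_add_finrank_orthogonal
    have h2 := finrank_span_finset_le_card (R := ℝ) ({x, u} : Finset (EuclideanSpace ℝ (Fin 3)))
    have h3 := Finset.card_le_two (a := x) (b := u)
    rw [hbot, finrank_bot, finrank_euclideanSpace_fin] at h1
    rw [Set.finrank, Finset.coe_pair] at h2
    omega
  have hxw : inner ℝ x w = 0 := hw x (Submodule.subset_span (by simp))
  have huw : inner ℝ u w = 0 := hw u (Submodule.subset_span (by simp))
  have hux := (real_inner_comm x u).trans hxu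
  have hwx := (real_inner_comm x w).trans hxw
  have hwu := (real_inner_comm u w).trans huw
  have hli : LinearIndependent ℝ ![x, u, w] := by
    refine linearIndependent_of_ne_zero_of_inner_eq_zero (𝕜 := ℝ) ?_ ?_
    · intro i
      fin_cases i <;> simp [hx0, hu0, hw0]
    · intro i j hij
      fin_cases i <;> fin_cases j <;> simp_all
  have hspan := hli.span_eq_top_of_card_eq_finrank' (by simp)
  have hXYZ : ∀ z, z = X z • x + dual u z • u + dual w z • w := by
    intro z
    have hz : z ∈ Submodule.span ℝ (Set.range ![x, u, w]) := hspan ▸ Submodule.mem_top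
    have hrange : Set.range ![x, u, w] = {x, u, w} := by
      ext v
      simp only [Set.mem_range, Fin.exists_fin_succ, Set.mem_insert_iff, Set.mem_singleton_iff]
      simp [eq_comm]
    rw [hrange] at hz
    obtain ⟨a, b, c, rfl⟩ := Submodule.mem_span_triple.1 hz
    simp [hXx, hXu, show X w = 0 from hdual0 _ _ hxw, hdual0 _ _ hux, hdual0 _ _ huw,
      hdual0 _ _ hwx, hdual0 _ _ hwu, hdual1 _ hu0, hdual1 _ hw0]
  exact not_tendsto_direction_extremePoints hKconv h0 (fun P hP => (hsec P hP).2.2.2) hx hxK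
    X (dual u) (dual w) hXx hXu (hdual0 _ _ hux) (hdual1 _ hu0) (hdual0 _ _ huw)
    (hdual0 _ _ hwx) (hdual0 _ _ hwu) (hdual1 _ hw0) hXYZ U hUx hUK
    (fun z => ‖z - X z • x‖⁻¹) (hrne.mono fun z hz => by positivity) hdir

end
end
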